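/- arXiv:2006.07668 — 3 statements merged into one kernel-verified Lean document; each statement's English description precedes it below -/
import Mathlib

section
/- Fix a positive integer T and for each positive integer L ≤ T define g(L) = (1/L)·[ (T mod L)·(1-(1-p)^{⌈T/L⌉}) + (L - (T mod L))·(1-(1-p)^{⌊T/L⌋}) ]. Then: (i) if p = 1, g(L) = 1 for all L ∈ {1,...,T}; and (ii) if p ∈ (0,1), then g is strictly decreasing on {1,...,T}, i.e., g(L) > g(L+1) for all 1 ≤ L ≤ T-1. Moreover, for any p ∈ (0,1], the function L ↦ T·p/L is strictly decreasing in L over the positive integers. -/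
/-- For `L ∤ T` the ceiling of `T / L` exceeds the floor by one. -/
theorem natCeil_div_eq_succ {T L : ℕ} (hL : 0 < L) (hr : 0 < T % L) :
    ⌈(T : ℝ) / (L : ℝ)⌉₊ = T / L + 1 := by
  have hL' : (0 : ℝ) < L := by exact_mod_cast hL
  have hT : (T : ℝ) = L * (T / L : ℕ) + (T % L : ℕ) := by
    exact_mod_cast (Nat.div_add_mod T L).symm
  have hr' : (0 : ℝ) < (T % L : ℕ) := by exact_mod_cast hr
  have hrL : ((T % L : ℕ) : ℝ) < L := by exact_mod_cast Nat.mod_lt T hL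
  rw [Nat.ceil_eq_iff (Nat.succ_ne_zero _)]
  constructor
  · rw [Nat.succ_sub_one, lt_div_iff₀ hL']
    linarith
  · rw [div_le_iff₀ hL']
    push_cast
    linarith

/-- The throughput formula is one minus the piecewise linear interpolation of `x ↦ (1 - p) ^ x`
at `x = T / L`. -/
theorem throughput_eq_one_sub {T L : ℕ} (hL : 0 < L) (p : ℝ) :
    (1 / (L : ℝ)) *
        (((T % L : ℕ) : ℝ) * (1 - (1 - p) ^ (⌈(T : ℝ) / (L : ℝ)⌉₊)) +
         ((L - T % L : ℕ) : ℝ) * (1 - (1 - p) ^ (T / L))) =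
      1 - (1 - p) ^ (T / L) * (1 - p * ((T % L : ℕ) / L)) := by
  have hL' : (L : ℝ) ≠ 0 := by exact_mod_cast hL.ne'
  rw [Nat.cast_sub (Nat.mod_lt T hL).le]
  rcases Nat.eq_zero_or_pos (T % L) with hr | hr
  · rw [hr]
    field_simp
    simp only [Nat.cast_zero, zero_mul, zero_add, sub_zero]
    ring
  · rw [natCeil_div_eq_succ hL hr, pow_succ]
    field_simp
    ring

/-- The piecewise linear interpolation of `x ↦ (1 - p) ^ x` at `T / L` is strictly increasing
in `L ≤ T`. -/
theorem interpolated_pow_lt {T L M : ℕ} {p : ℝ} (hp : 0 < p) (hp1 : p < 1) (hL : 0 < L)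
    (hLM : L < M) (hMT : M ≤ T) :
    (1 - p) ^ (T / L) * (1 - p * ((T % L : ℕ) / L)) <
      (1 - p) ^ (T / M) * (1 - p * ((T % M : ℕ) / M)) := by
  have hM : 0 < M := hL.trans hLM
  have hL' : (0 : ℝ) < L := by exact_mod_cast hL
  have hM' : (0 : ℝ) < M := by exact_mod_cast hM
  have hq : 0 < 1 - p := sub_pos.2 hp1
  have hle : T / M ≤ T / L := Nat.div_le_div_left hLM.le hL
  rcases hle.eq_or_lt with h | h
  · rw [h]
    have hk : 0 < T / L := h ▸ Nat.div_pos hMT hM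
    have hlt : T % M < T % L := by
      have h1 := Nat.div_add_mod T L
      have h2 := Nat.div_add_mod T M
      rw [h] at h2
      have h3 := Nat.mul_lt_mul_of_pos_right hLM hk
      omega
    have hfrac : ((T % M : ℕ) : ℝ) / M < (T % L : ℕ) / L := by
      have hlt' : ((T % M : ℕ) : ℝ) < (T % L : ℕ) := by exact_mod_cast hlt
      have hLM' : (L : ℝ) ≤ M := by exact_mod_cast hLM.le
      exact div_lt_div₀ hlt' hLM' (Nat.cast_nonneg _) hL'
    gcongr
  · have hfrac : ((T % M : ℕ) : ℝ) / M < 1 := by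
      rw [div_lt_one hM']
      exact_mod_cast Nat.mod_lt T hM
    calc (1 - p) ^ (T / L) * (1 - p * ((T % L : ℕ) / L)) ≤ (1 - p) ^ (T / L) :=
          mul_le_of_le_one_right (by positivity) (sub_le_self _ (by positivity))
      _ ≤ (1 - p) ^ (T / M + 1) := pow_le_pow_of_le_one hq.le (by linarith) h
      _ = (1 - p) ^ (T / M) * (1 - p) := pow_succ _ _
      _ < _ := by
          gcongr
          exact mul_lt_of_lt_one_right hp hfrac


/-- Lemma 1 of the paper: with `g(L)` the case-2 timely throughput
`(1/L)·[(T mod L)·(1-(1-p)^{⌈T/L⌉}) + (L - T mod L)·(1-(1-p)^{⌊T/L⌋})]`,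
(i) if `p = 1` then `g(L) = 1` for all `1 ≤ L ≤ T`;
(ii) if `p ∈ (0,1)` then `g` is strictly decreasing on `{1,…,T}`;
moreover, for any `p ∈ (0,1]`, `L ↦ T·p/L` is strictly decreasing over the
positive integers. -/
theorem stmt_4 (T : ℕ) (hT : 0 < T) (p : ℝ) (g : ℕ → ℝ)
    (hg : ∀ L : ℕ, 0 < L → g L =
      (1 / (L : ℝ)) *
        (((T % L : ℕ) : ℝ) * (1 - (1 - p) ^ (⌈(T : ℝ) / (L : ℝ)⌉₊)) +
         ((L - T % L : ℕ) : ℝ) * (1 - (1 - p) ^ (T / L)))) :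
    (p = 1 → ∀ L ∈ Finset.Icc 1 T, g L = 1) ∧
    (0 < p → p < 1 → ∀ L : ℕ, 1 ≤ L → L + 1 ≤ T → g L > g (L + 1)) ∧
    (0 < p → p ≤ 1 → ∀ L₁ L₂ : ℕ, 0 < L₁ → L₁ < L₂ →
      (T : ℝ) * p / (L₁ : ℝ) > (T : ℝ) * p / (L₂ : ℝ)) := by
  refine ⟨?_, ?_, ?_⟩
  · rintro rfl L hL
    obtain ⟨hL1, hLT⟩ := Finset.mem_Icc.1 hL
    rw [hg L hL1, throughput_eq_one_sub hL1, sub_self, zero_pow (Nat.div_pos hLT hL1).ne']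
    simp
  · intro hp hp1 L hL hLT
    rw [hg L hL, hg (L + 1) L.succ_pos, throughput_eq_one_sub hL,
      throughput_eq_one_sub L.succ_pos]
    exact sub_lt_sub_left (interpolated_pow_lt hp hp1 hL L.lt_succ_self hLT) 1
  · intro hp _ L₁ L₂ h1 h12
    have hT' : (0 : ℝ) < T := by exact_mod_cast hT
    exact div_lt_div_of_pos_left (mul_pos hT' hp) (by exact_mod_cast h1) (by exact_mod_cast h12)
end

section
/- For positive integers D and N, let q(D,N) be the least prime power q such that there exists a natural number k ≥ 0 with q ≥ kD + 1 and q^{k+1} ≥ N. If D > √(2N) (equivalently, D² > 2N), then q(D,N)² > N. -/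
/-- Proposition 2 of the paper: if `D² > 2N`, then the period `q(D,N)²` of the GF
sequence scheme exceeds the period `N` of TDMA, where `q(D,N)` is the least prime
power `q` admitting a `k ≥ 0` with `q ≥ kD + 1` and `q^{k+1} ≥ N`. -/
theorem stmt_11 (D N qv : ℕ) (hD : 0 < D) (hN : 0 < N)
    (hpp : IsPrimePow qv)
    (hfeas : ∃ k : ℕ, k * D + 1 ≤ qv ∧ N ≤ qv ^ (k + 1))
    (hmin : ∀ q' : ℕ, IsPrimePow q' → (∃ k : ℕ, k * D + 1 ≤ q' ∧ N ≤ q' ^ (k + 1)) →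
      qv ≤ q')
    (hDN : D ^ 2 > 2 * N) :
    qv ^ 2 > N := by
  obtain ⟨k, hk, hN'⟩ := hfeas
  have h2 : 2 ≤ qv := hpp.two_le
  rcases Nat.eq_zero_or_pos k with rfl | hk0
  · simp only [zero_add, pow_one] at hN'
    nlinarith
  · have hDq : D ≤ qv := by nlinarith
    have := Nat.pow_le_pow_left hDq 2
    omega
end

section
/- Let p ∈ (0,1] be real, let M be a positive integer, and let φ_1,...,φ_M be natural numbers with ∑_{k=1}^{M} φ_k = S. Then ∑_{k=1}^{M} (1-(1-p)^{φ_k}) ≤ (S mod M)·(1-(1-p)^{⌈S/M⌉}) + (M - (S mod M))·(1-(1-p)^{⌊S/M⌋}). In other words, among all nonnegative-integer vectors of length M with fixed sum S, the sum ∑_k (1-(1-p)^{φ_k}) is maximized by the balanced vector having (S mod M) entries equal to ⌈S/M⌉ and the rest equal to ⌊S/M⌋. -/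
/-- The graph of `n ↦ x ^ n` lies above the secant line through `q` and `q + 1`. -/
theorem pow_sub_mul_le_pow {x : ℝ} (hx0 : 0 ≤ x) (hx1 : x ≤ 1) (q n : ℕ) :
    x ^ q - x ^ q * (1 - x) * ((n : ℝ) - q) ≤ x ^ n := by
  rcases le_total q n with h | h
  · obtain ⟨k, rfl⟩ := Nat.exists_eq_add_of_le h
    have hb := one_add_mul_le_pow (a := x - 1) (by linarith) k
    rw [add_sub_cancel] at hb
    have := mul_le_mul_of_nonneg_left hb (pow_nonneg hx0 q)
    rw [pow_add]
    push_cast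
    linarith
  · obtain ⟨k, rfl⟩ := Nat.exists_eq_add_of_le h
    have hb := one_add_mul_le_pow (a := 1 - x) (by linarith) k
    have hk : x ^ k * (1 + k * (1 - x)) ≤ 1 :=
      calc x ^ k * (1 + k * (1 - x)) ≤ x ^ k * (1 + (1 - x)) ^ k := by gcongr
        _ = (x * (1 + (1 - x))) ^ k := (mul_pow _ _ _).symm
        _ ≤ 1 := pow_le_one₀ (by nlinarith) (by nlinarith [sq_nonneg (1 - x)])
    have := mul_le_mul_of_nonneg_left hk (pow_nonneg hx0 n)
    rw [pow_add]
    push_cast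
    linarith

theorem natCeil_div_eq_div_add_one {S M : ℕ} (hM : 0 < M) (h : S % M ≠ 0) :
    ⌈(S : ℝ) / (M : ℝ)⌉₊ = S / M + 1 := by
  have hM' : (0 : ℝ) < M := by exact_mod_cast hM
  have hdm := Nat.div_add_mod S M
  have hlt := Nat.mod_lt S hM
  rw [Nat.ceil_eq_iff (Nat.add_one_ne_zero _), Nat.add_sub_cancel, lt_div_iff₀ hM', div_le_iff₀ hM']
  constructor
  · have : S / M * M < S := by rw [mul_comm]; omega
    exact_mod_cast this
  · have : S ≤ (S / M + 1) * M := by rw [add_mul, mul_comm]; omega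
    exact_mod_cast this

/-- Core extremal inequality in the proof of Proposition 3: among nonnegative
integer vectors `φ` of length `M` with fixed sum `S`, the quantity
`∑ₖ (1-(1-p)^{φₖ})` is maximized by the balanced vector with `S mod M` entries
equal to `⌈S/M⌉` and the rest equal to `⌊S/M⌋`. -/
theorem stmt_12 (p : ℝ) (hp0 : 0 < p) (hp1 : p ≤ 1) (M : ℕ) (hM : 0 < M)
    (φ : Fin M → ℕ) (S : ℕ) (hS : S = ∑ k, φ k) :
    ∑ k, (1 - (1 - p) ^ (φ k)) ≤
      ((S % M : ℕ) : ℝ) * (1 - (1 - p) ^ (⌈(S : ℝ) / (M : ℝ)⌉₊)) +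
      ((M - S % M : ℕ) : ℝ) * (1 - (1 - p) ^ (S / M)) := by
  have hsum : ∑ k, ((1 - p) ^ (S / M) - (1 - p) ^ (S / M) * (1 - (1 - p)) *
      ((φ k : ℝ) - (S / M : ℕ))) ≤ ∑ k, (1 - p) ^ φ k :=
    Finset.sum_le_sum fun k _ =>
      pow_sub_mul_le_pow (by linarith) (by linarith) (S / M) (φ k)
  have hS' : (S : ℝ) = ∑ k, (φ k : ℝ) := by rw [hS]; push_cast; rfl
  have hdm : (M : ℝ) * (S / M : ℕ) + (S % M : ℕ) = S := by
    exact_mod_cast Nat.div_add_mod S M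
  have hceil : ((S % M : ℕ) : ℝ) * (1 - (1 - p) ^ (⌈(S : ℝ) / (M : ℝ)⌉₊)) =
      ((S % M : ℕ) : ℝ) * (1 - (1 - p) ^ (S / M + 1)) := by
    by_cases h : S % M = 0
    · simp [h]
    · rw [natCeil_div_eq_div_add_one hM h]
  rw [hceil, Nat.cast_sub (Nat.mod_lt S hM).le, Finset.sum_sub_distrib]
  rw [Finset.sum_sub_distrib, ← Finset.mul_sum, Finset.sum_sub_distrib, ← hS', ← hdm] at hsum
  simp only [Finset.sum_const, Finset.card_univ, Fintype.card_fin, nsmul_eq_mul] at hsum ⊢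
  rw [pow_succ]
  linarith
end
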